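/- arXiv:1708.00934 — 3 statements merged into one kernel-verified Lean document; each statement's English description precedes it below -/
import Mathlib

section
/- Let T be a tree and let v ∈ Supp(T) be a vertex in the support of the null space of T. Then no neighbor of v lies in Supp(T); that is, N(v) ∩ Supp(T) = ∅, so Supp(T) is an independent set of T. -/
open scoped Classical

namespace NullDecomp

variable {V : Type*}

/-- The null space of the real adjacency matrix of a graph. -/
def nullSpace [Fintype V] (G : SimpleGraph V) : Set (V → ℝ) :=
  {x | Matrix.mulVec (G.adjMatrix ℝ) x = 0}

/-- The support of the null space: vertices with a nonzero entry in some null vector. -/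
def supportSet [Fintype V] (G : SimpleGraph V) : Set V :=
  {v | ∃ x ∈ nullSpace G, x v ≠ 0}

/-- The (open) neighborhood of a set of vertices. -/
def nbhdSet (G : SimpleGraph V) (A : Set V) : Set V :=
  {v | ∃ u ∈ A, G.Adj u v}

/-- The closed neighborhood of a set of vertices. -/
def closedNbhd (G : SimpleGraph V) (A : Set V) : Set V :=
  A ∪ nbhdSet G A

/-- The core of a graph: the neighborhood of the support of the null space. -/
def coreSet [Fintype V] (G : SimpleGraph V) : Set V :=
  nbhdSet G (supportSet G)

/-- A tree is an S-tree if the closed neighborhood of its support is everything. -/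
def IsSTree [Fintype V] (G : SimpleGraph V) : Prop :=
  G.IsTree ∧ closedNbhd G (supportSet G) = Set.univ

/-- A matching: a set of edges of `G`, pairwise disjoint. -/
def IsMatchingSet (G : SimpleGraph V) (M : Finset (Sym2 V)) : Prop :=
  (↑M : Set (Sym2 V)) ⊆ G.edgeSet ∧
    ∀ e ∈ M, ∀ f ∈ M, e ≠ f → ∀ v : V, v ∈ e → v ∉ f

/-- A maximum matching. -/
def IsMaxMatching [Fintype V] (G : SimpleGraph V) (M : Finset (Sym2 V)) : Prop :=
  IsMatchingSet G M ∧ ∀ M' : Finset (Sym2 V), IsMatchingSet G M' → M'.card ≤ M.card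

/-- The matching number. -/
noncomputable def matchingNumber [Fintype V] (G : SimpleGraph V) : ℕ :=
  sSup {n | ∃ M : Finset (Sym2 V), IsMatchingSet G M ∧ M.card = n}

/-- An independent set of vertices. -/
def IsIndep (G : SimpleGraph V) (A : Set V) : Prop :=
  ∀ u ∈ A, ∀ w ∈ A, ¬ G.Adj u w

/-- The independence number. -/
noncomputable def indepNumber [Fintype V] (G : SimpleGraph V) : ℕ :=
  sSup {n | ∃ A : Set V, IsIndep G A ∧ A.ncard = n}

/-- A vertex cover. -/
def IsVertexCover (G : SimpleGraph V) (Cs : Set V) : Prop :=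
  ∀ e ∈ G.edgeSet, ∃ v ∈ Cs, v ∈ e

/-- The vertex cover number. -/
noncomputable def coverNumber [Fintype V] (G : SimpleGraph V) : ℕ :=
  sInf {n | ∃ Cs : Set V, IsVertexCover G Cs ∧ Cs.ncard = n}

/-- The nullity of a graph: dimension of the kernel of its adjacency matrix. -/
noncomputable def nullity [Fintype V] (G : SimpleGraph V) : ℕ :=
  Module.finrank ℝ (LinearMap.ker (Matrix.mulVecLin (G.adjMatrix ℝ)))

/-- The number of maximum matchings of a graph. -/
noncomputable def numMaxMatchings [Fintype V] (G : SimpleGraph V) : ℕ :=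
  Set.ncard {M : Finset (Sym2 V) | IsMaxMatching G M}

/-- `C` is (the vertex set of) a connected component of the subgraph of `T`
induced by the closed neighborhood of the support of `T`. -/
def IsSComponent [Fintype V] (T : SimpleGraph V) (C : Set V) : Prop :=
  ∃ c : (T.induce (closedNbhd T (supportSet T))).ConnectedComponent,
    C = Subtype.val '' c.supp

/-- `C` is (the vertex set of) a connected component of the subgraph of `T`
induced by the complement of the closed neighborhood of the support of `T`. -/
def IsNComponent [Fintype V] (T : SimpleGraph V) (C : Set V) : Prop :=
  ∃ c : (T.induce ((closedNbhd T (supportSet T))ᶜ)).ConnectedComponent,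
    C = Subtype.val '' c.supp

/-- The zero-extension to `ℝ^V` of the null space of the subgraph of `T` induced by `C`:
vectors vanishing outside `C` whose restriction to `C` is a null vector of `T.induce C`. -/
noncomputable def extNull [Fintype V] (T : SimpleGraph V) (C : Set V) : Submodule ℝ (V → ℝ) :=
  LinearMap.ker ((Matrix.mulVecLin ((T.induce C).adjMatrix ℝ)).comp
      (LinearMap.funLeft ℝ ℝ (Subtype.val : ↥C → V))) ⊓
  LinearMap.ker (LinearMap.funLeft ℝ ℝ (Subtype.val : ↥(Cᶜ) → V))

/-- The vectors of the null space are those whose neighbor sums all vanish. -/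
lemma mem_nullSpace_iff [Fintype V] {G : SimpleGraph V} {x : V → ℝ} :
    x ∈ nullSpace G ↔ ∀ u, ∑ z, (if G.Adj u z then x z else 0) = 0 := by
  simp only [nullSpace, Set.mem_ofPred_eq, funext_iff, Matrix.mulVec, dotProduct,
    SimpleGraph.adjMatrix_apply, ite_mul, one_mul, zero_mul, Pi.zero_apply]

/-- Changing signs on one color class of a two-coloring preserves the null space. -/
lemma signed_mem_nullSpace [Fintype V] {G : SimpleGraph V} {e y : V → ℝ}
    (he : ∀ a b, G.Adj a b → e b = -e a) (hy : y ∈ nullSpace G) :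
    (fun u ↦ e u * y u) ∈ nullSpace G := by
  rw [mem_nullSpace_iff] at hy ⊢
  intro u
  have h : ∀ z, (if G.Adj u z then e z * y z else 0) =
      -e u * (if G.Adj u z then y z else 0) := by
    intro z
    split_ifs with hz
    · rw [he u z hz]
    · simp
  simp only [h, ← Finset.mul_sum, hy u, mul_zero]

/-- Across a bridge, any two null vectors have vanishing `2 × 2` minor. -/
lemma mul_eq_mul_of_isBridge [Fintype V] {G : SimpleGraph V} {v w : V} (hvw : G.Adj v w)
    (hb : ¬ (G.deleteEdges {s(v, w)}).Reachable v w) {x y : V → ℝ}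
    (hx : x ∈ nullSpace G) (hy : y ∈ nullSpace G) :
    x v * y w = x w * y v := by
  rw [mem_nullSpace_iff] at hx hy
  let R : V → Prop := fun u ↦ (G.deleteEdges {s(v, w)}).Reachable v u
  let s : V → ℝ := fun u ↦ if R u then 1 else 0
  have hsv : s v = 1 := if_pos (SimpleGraph.Reachable.refl v)
  have hsw : s w = 0 := if_neg hb
  have hne : v ≠ w := hvw.ne
  have hs : ∀ a b, G.Adj a b → s(a, b) ≠ s(v, w) → s a = s b := by
    intro a b hab hr
    have hab' : (G.deleteEdges {s(v, w)}).Adj a b := by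
      rw [SimpleGraph.deleteEdges_adj]
      exact ⟨hab, hr⟩
    have : R a ↔ R b :=
      ⟨fun h ↦ h.trans hab'.reachable, fun h ↦ h.trans hab'.symm.reachable⟩
    simp only [s, this]
  have key : ∀ a b, (if G.Adj a b then (s a - s b) * (x a * y b) else 0) =
      (if a = v then (if b = w then x v * y w else 0) else 0) -
      (if a = w then (if b = v then x w * y v else 0) else 0) := by
    intro a b
    by_cases h₁ : a = v ∧ b = w
    · obtain ⟨rfl, rfl⟩ := h₁
      simp [hvw, hsv, hsw, hne]
    by_cases h₂ : a = w ∧ b = v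
    · obtain ⟨rfl, rfl⟩ := h₂
      simp [hvw.symm, hsv, hsw, hne.symm]
    have hr : ¬ s(a, b) = s(v, w) := by
      rw [Sym2.eq_iff]
      tauto
    rw [← ite_and, ← ite_and, if_neg h₁, if_neg h₂, sub_zero, ite_eq_right_iff]
    intro hab
    rw [hs a b hab hr, sub_self, zero_mul]
  have hsum : ∑ a, ∑ b, (if G.Adj a b then (s a - s b) * (x a * y b) else 0) =
      x v * y w - x w * y v := by
    simp only [key, Finset.sum_sub_distrib, Finset.sum_ite_irrel, Finset.sum_ite_eq',
      Finset.sum_const_zero, Finset.mem_univ, if_true]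
  have hsplit : ∑ a, ∑ b, (if G.Adj a b then (s a - s b) * (x a * y b) else 0) =
      ∑ a, s a * x a * ∑ b, (if G.Adj a b then y b else 0) -
      ∑ b, s b * y b * ∑ a, (if G.Adj b a then x a else 0) := by
    simp only [Finset.mul_sum]
    rw [Finset.sum_comm (f := fun b a ↦ s b * y b * (if G.Adj b a then x a else 0))]
    simp only [← Finset.sum_sub_distrib]
    refine Finset.sum_congr rfl fun a _ ↦ Finset.sum_congr rfl fun b _ ↦ ?_
    simp only [G.adj_comm b a]
    split_ifs <;> ring
  simp only [hx, hy, mul_zero, Finset.sum_const_zero, sub_self] at hsplit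
  linarith

/-- In a tree `T`, no neighbor of a supported vertex is supported:
the support of the null space is an independent set. -/
theorem stmt1 [Fintype V] (T : SimpleGraph V) (hT : T.IsTree)
    {v : V} (hv : v ∈ supportSet T) :
    T.neighborSet v ∩ supportSet T = ∅ := by
  rw [Set.eq_empty_iff_forall_notMem]
  rintro w ⟨hvw, y, hy, hyw⟩
  obtain ⟨x, hx, hxv⟩ := hv
  rw [SimpleGraph.mem_neighborSet] at hvw
  have hb : ¬ (T.deleteEdges {s(v, w)}).Reachable v w :=
    SimpleGraph.isBridge_iff.mp
      (SimpleGraph.isAcyclic_iff_forall_adj_isBridge.mp hT.isAcyclic hvw)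
  obtain ⟨c⟩ := hT.colorable_two
  let e : V → ℝ := fun u ↦ if c u = 0 then 1 else -1
  have he : ∀ a b, T.Adj a b → e b = -e a := by
    intro a b hab
    have hc := c.valid hab
    by_cases ha : c a = 0
    · have hb' : c b ≠ 0 := by omega
      simp [e, ha, hb']
    · have hb' : c b = 0 := by omega
      simp [e, ha, hb']
  have hev : e v ≠ 0 := by
    simp only [e]
    split_ifs <;> norm_num
  have h₁ := mul_eq_mul_of_isBridge hvw hb hx hy
  have h₂ := mul_eq_mul_of_isBridge hvw hb hx (signed_mem_nullSpace he hy)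
  simp only [he v w hvw] at h₂
  have h₃ : e v * (x v * y w) = 0 := by linear_combination (e v / 2) * h₁ - h₂ / 2
  exact mul_ne_zero hev (mul_ne_zero hxv hyw) h₃

end NullDecomp
end

section
/- Let S be an S-tree and let v ∈ Core(S). Then v has at least two neighbors in Supp(S); that is, |N(v) ∩ Supp(S)| ≥ 2. -/
open scoped Classical

namespace NullDecomp

variable {V : Type*}

/-- Every core vertex of an S-tree has at least two supported neighbors. -/
theorem stmt3 [Fintype V] (S : SimpleGraph V) (hS : IsSTree S)
    {v : V} (hv : v ∈ coreSet S) :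
    2 ≤ (S.neighborSet v ∩ supportSet S).ncard := by
  obtain ⟨u, ⟨x, hx, hxu⟩, huv⟩ := hv
  have hsum : ∑ w ∈ S.neighborFinset v, x w = 0 := by
    rw [← SimpleGraph.adjMatrix_mulVec_apply]
    exact congrFun hx v
  have hu : u ∈ S.neighborFinset v := by simpa using huv.symm
  obtain ⟨w, hw, hwu, hxw⟩ : ∃ w ∈ S.neighborFinset v, w ≠ u ∧ x w ≠ 0 := by
    by_contra! h
    exact hxu ((Finset.sum_eq_single_of_mem u hu h).symm.trans hsum)
  exact (Set.one_lt_ncard (Set.toFinite _)).2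
    ⟨u, ⟨huv.symm, x, hx, hxu⟩, w, ⟨by simpa using hw, x, hx, hxw⟩, hwu.symm⟩

end NullDecomp
end

section
/- Let S be an S-tree and let v ∈ Supp(S). Then there exists a maximum matching M of S that does not saturate v, i.e., v is not an endpoint of any edge of M. -/
open scoped Classical

namespace NullDecomp

variable {V : Type*}

theorem eq_of_adj_of_dist_lt {G : SimpleGraph V} (hG : G.IsTree) {r w a b : V}
    (ha : G.Adj w a) (hb : G.Adj w b) (hda : G.dist r a < G.dist r w)
    (hdb : G.dist r b < G.dist r w) : a = b := by
  obtain ⟨p, hp, -⟩ := hG.connected.exists_path_of_dist r w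
  have parent_eq : ∀ c, G.Adj w c → G.dist r c < G.dist r w → c = p.penultimate := by
    intro c hc hdc
    refine hG.isAcyclic.eq_penultimate_of_adj_end hp hc ?_
    obtain ⟨q, hq, hql⟩ := hG.connected.exists_path_of_dist r c
    refine hG.isAcyclic.mem_support_of_ne_mem_support_of_adj_of_isPath hp hq hc fun hw ↦ ?_
    have h₁ := SimpleGraph.dist_le (q.takeUntil w hw)
    have h₂ := q.length_takeUntil_le_length hw
    omega
  rw [parent_eq a ha hda, parent_eq b hb hdb]

theorem exists_ne_adj_ne_zero [Fintype V] {G : SimpleGraph V} {x : V → ℝ}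
    (hx : x ∈ nullSpace G) {w a : V} (ha : G.Adj w a) (hxa : x a ≠ 0) :
    ∃ b, b ≠ a ∧ G.Adj w b ∧ x b ≠ 0 := by
  have hsum : ∑ u ∈ G.neighborFinset w, x u = 0 := by
    rw [← SimpleGraph.adjMatrix_mulVec_apply]
    exact congrFun hx w
  by_contra! h
  refine hxa ?_
  rw [← hsum, Finset.sum_eq_single a]
  · exact fun b hb hne ↦ h b hne ((G.mem_neighborFinset w b).mp hb)
  · exact fun hn ↦ absurd ((G.mem_neighborFinset w a).mpr ha) hn

theorem IsMatchingSet.subset {G : SimpleGraph V} {M N : Finset (Sym2 V)}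
    (hM : IsMatchingSet G M) (h : N ⊆ M) : IsMatchingSet G N :=
  ⟨fun _ he ↦ hM.1 (h he), fun e he f hf ↦ hM.2 e (h he) f (h hf)⟩

theorem IsMatchingSet.insert {G : SimpleGraph V} {M : Finset (Sym2 V)} {a b : V}
    (hM : IsMatchingSet G M) (hab : G.Adj a b) (ha : ∀ e ∈ M, a ∉ e) (hb : ∀ e ∈ M, b ∉ e) :
    IsMatchingSet G (insert s(a, b) M) := by
  constructor
  · intro e he
    rcases Finset.mem_insert.mp he with rfl | he
    · exact hab
    · exact hM.1 he
  · intro e he f hf hne z hze hzf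
    rcases Finset.mem_insert.mp he with rfl | heM <;>
      rcases Finset.mem_insert.mp hf with rfl | hfM
    · exact hne rfl
    · rcases Sym2.mem_iff.mp hze with rfl | rfl
      · exact ha f hfM hzf
      · exact hb f hfM hzf
    · rcases Sym2.mem_iff.mp hzf with rfl | rfl
      · exact ha e heM hze
      · exact hb e heM hze
    · exact hM.2 e heM f hfM hne z hze hzf

/-- In a tree rooted at `r`, a matching can be exchanged along an alternating path going away from
the root so as to miss a vertex `u` in the support of a null vector, provided `u` is not matched to
its parent. -/
theorem exists_isMatchingSet_card_eq_missing [Fintype V] {G : SimpleGraph V} (hG : G.IsTree)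
    (r : V) {x : V → ℝ} (hx : x ∈ nullSpace G) (M : Finset (Sym2 V)) (hM : IsMatchingSet G M)
    (u : V) (hxu : x u ≠ 0) (hu : ∀ w, s(u, w) ∈ M → G.dist r u < G.dist r w) :
    ∃ N : Finset (Sym2 V), IsMatchingSet G N ∧ N.card = M.card ∧ (∀ e ∈ N, u ∉ e) ∧
      ∀ z, G.dist r z < G.dist r u → (∀ e ∈ M, z ∉ e) → ∀ e ∈ N, z ∉ e := by
  induction hn : M.card using Nat.strong_induction_on generalizing M u with
  | _ n ih =>
    subst hn
    by_cases hmiss : ∀ e ∈ M, u ∉ e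
    · exact ⟨M, hM, rfl, hmiss, fun _ _ h ↦ h⟩
    push Not at hmiss
    obtain ⟨e, he, hue⟩ := hmiss
    obtain ⟨w, rfl⟩ := Sym2.mem_iff_exists.mp hue
    have huw : G.Adj u w := hM.1 he
    have hdw := hu w he
    obtain ⟨t, htu, hwt, hxt⟩ := exists_ne_adj_ne_zero hx huw.symm hxu
    have hdt : G.dist r w < G.dist r t := by
      rcases lt_or_ge (G.dist r w) (G.dist r t) with h | h
      · exact h
      · exact absurd (eq_of_adj_of_dist_lt hG hwt huw.symm
          (h.lt_of_ne (hG.dist_ne_of_adj r hwt).symm) hdw) htu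
    have herase : ∀ z ∈ s(u, w), ∀ f ∈ M.erase s(u, w), z ∉ f := fun z hz f hf ↦
      hM.2 _ he f (Finset.mem_of_mem_erase hf) (Finset.ne_of_mem_erase hf).symm z hz
    have hwmiss := herase w (Sym2.mem_mk_right u w)
    have hMe := hM.subset (Finset.erase_subset s(u, w) M)
    have hcard := Finset.card_erase_add_one he
    obtain ⟨N, hN, hNcard, hNt, hNz⟩ := ih _ (Finset.card_erase_lt_of_mem he) _ hMe t hxt (by
      intro y hy
      by_contra! hle
      have hty : G.Adj t y := hMe.1 hy
      have := eq_of_adj_of_dist_lt hG hty hwt.symm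
        (hle.lt_of_ne (hG.dist_ne_of_adj r hty).symm) hdt
      subst this
      exact hwmiss _ hy (Sym2.mem_mk_right t y)) rfl
    have hNw := hNz w hdt hwmiss
    have hNu := hNz u (hdw.trans hdt) (herase u (Sym2.mem_mk_left u w))
    refine ⟨insert s(w, t) N, hN.insert hwt hNw hNt, ?_, ?_, ?_⟩
    · rw [Finset.card_insert_of_notMem fun h ↦ hNw _ h (Sym2.mem_mk_left w t)]
      omega
    · intro f hf huf
      rcases Finset.mem_insert.mp hf with rfl | hf
      · rcases Sym2.mem_iff.mp huf with h | h
        · exact huw.ne h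
        · exact htu h.symm
      · exact hNu f hf huf
    · intro z hz hzM f hf hzf
      rcases Finset.mem_insert.mp hf with rfl | hf
      · rcases Sym2.mem_iff.mp hzf with rfl | rfl <;> omega
      · exact hNz z (by omega) (fun g hg ↦ hzM g (Finset.mem_of_mem_erase hg)) f hf hzf

theorem exists_isMaxMatching [Fintype V] (G : SimpleGraph V) :
    ∃ M : Finset (Sym2 V), IsMaxMatching G M := by
  obtain ⟨M, hM, hmax⟩ := Finset.exists_max_image
    (Finset.univ.filter fun M : Finset (Sym2 V) ↦ IsMatchingSet G M) Finset.card
    ⟨∅, Finset.mem_filter.mpr ⟨Finset.mem_univ _, by simp [IsMatchingSet]⟩⟩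
  exact ⟨M, (Finset.mem_filter.mp hM).2, fun N hN ↦ hmax N (by simpa using hN)⟩

/-- Every supported vertex of an S-tree is missed by some maximum matching. -/
theorem stmt10 [Fintype V] (S : SimpleGraph V) (hS : IsSTree S)
    {v : V} (hv : v ∈ supportSet S) :
    ∃ M : Finset (Sym2 V), IsMaxMatching S M ∧ ∀ e ∈ M, v ∉ e := by
  obtain ⟨x, hx, hxv⟩ := hv
  obtain ⟨M, hM, hmax⟩ := exists_isMaxMatching S
  obtain ⟨N, hN, hcard, hNv, -⟩ := exists_isMatchingSet_card_eq_missing hS.1 v hx M hM v hxv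
    fun w hw ↦ by
      rw [SimpleGraph.dist_self]
      exact hS.1.connected.pos_dist_of_ne (SimpleGraph.Adj.ne (hM.1 hw))
  exact ⟨N, ⟨hN, fun M' hM' ↦ hcard ▸ hmax M' hM'⟩, hNv⟩

end NullDecomp
end
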